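/- arXiv:2602.20392 — 2 statements merged into one kernel-verified Lean document; each statement's English description precedes it below -/
import Mathlib

section
/- Suppose |A| ≥ 2. Then for every k ≥ 2, with N = M^k, the inequality t_k ≤ |C_k|⁴/N² is strict: t_k < |A|^{4k}/M^{2k}. -/
open scoped BigOperators

/-- The Cantor iterates `C_k = {Σ_{j<k} a_j M^j : a_j ∈ A} ⊆ {0,…,M^k-1}`. -/
def Ck (M : ℕ) (A : Finset ℕ) (k : ℕ) : Finset ℕ :=
  (Fintype.piFinset fun _ : Fin k => A).image fun a => ∑ j : Fin k, a j * M ^ (j : ℕ)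

/-- The discrete Fourier transform of the indicator function of `S ⊆ Z_N`,
`F_N(1_S)(m) = N^{-1/2} Σ_{l<N} 1_S(l) exp(-2πi m l / N)`; it is `N`-periodic in `m`,
so a residue `m ∈ Z_N` may be fed in via any integer representative. -/
noncomputable def dftInd (N : ℕ) (S : Finset ℕ) (m : ℕ) : ℂ :=
  ((1 : ℝ) / Real.sqrt N : ℝ) * ∑ l ∈ Finset.range N,
    (if l ∈ S then (1 : ℂ) else 0) * Complex.exp (-(2 * (Real.pi : ℂ) * Complex.I * m * l) / N)

/-- `t_k = (1/N) Σ_{j,ℓ ∈ Z_N} 1_{C_k}(j) 1_{C_k}(ℓ) |F_N(1_{C_k})(ℓ-j)|²`, `N = M^k`,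
where `ℓ - j` is taken in `Z_N` (represented by `ℓ + N - j ≡ ℓ - j (mod N)`). -/
noncomputable def tk (M : ℕ) (A : Finset ℕ) (k : ℕ) : ℝ :=
  ((1 : ℝ) / ((M ^ k : ℕ) : ℝ)) * ∑ j ∈ Finset.range (M ^ k), ∑ l ∈ Finset.range (M ^ k),
    (if j ∈ Ck M A k then (1 : ℝ) else 0) * (if l ∈ Ck M A k then (1 : ℝ) else 0) *
      ‖dftInd (M ^ k) (Ck M A k) (l + M ^ k - j)‖ ^ 2

/-- The additive energy of `X ⊆ Z_N`. -/
def addE (N : ℕ) (X : Finset ℕ) : ℕ :=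
  (((X ×ˢ X) ×ˢ (X ×ˢ X)).filter fun p => (p.1.1 + p.1.2) % N = (p.2.1 + p.2.2) % N).card

theorem sum_mul_pow_lt_pow {M k : ℕ} (a : Fin k → ℕ) (ha : ∀ i, a i < M) :
    ∑ i, a i * M ^ (i : ℕ) < M ^ k := by
  induction k with
  | zero => simp
  | succ k ih =>
    rw [Fin.sum_univ_castSucc, pow_succ']
    have h := ih (fun i => a i.castSucc) fun i => ha _
    have hl : (a (Fin.last k) + 1) * M ^ k ≤ M * M ^ k := Nat.mul_le_mul_right _ (ha _)
    simp only [Fin.val_castSucc, Fin.val_last]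
    linarith

theorem Ck_subset_range {M : ℕ} {A : Finset ℕ} (hA : A ⊆ Finset.range M) (k : ℕ) :
    Ck M A k ⊆ Finset.range (M ^ k) := by
  intro x hx
  obtain ⟨a, ha, rfl⟩ := Finset.mem_image.mp hx
  exact Finset.mem_range.mpr <| sum_mul_pow_lt_pow a fun i =>
    Finset.mem_range.mp (hA (Fintype.mem_piFinset.mp ha i))

theorem card_Ck_le (M : ℕ) (A : Finset ℕ) (k : ℕ) : (Ck M A k).card ≤ A.card ^ k := by
  refine Finset.card_image_le.trans ?_
  simp

/-- Two elements of `C_k` may differ in the lowest digit only. -/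
theorem exists_add_mem_Ck {M : ℕ} {A : Finset ℕ} {a d : ℕ} (ha : a ∈ A) (hd : a + d ∈ A)
    {k : ℕ} (hk : 0 < k) : ∃ j, j ∈ Ck M A k ∧ j + d ∈ Ck M A k := by
  obtain ⟨k, rfl⟩ := Nat.exists_eq_add_of_lt hk
  rw [zero_add]
  refine ⟨_, Finset.mem_image.mpr ⟨fun _ => a, Fintype.mem_piFinset.mpr fun _ => ha, rfl⟩,
    Finset.mem_image.mpr ⟨Fin.cons (a + d) fun _ => a, ?_, ?_⟩⟩
  · rw [Fintype.mem_piFinset]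
    exact Fin.cases hd fun _ => ha
  · simp only [Fin.sum_univ_succ, Fin.cons_zero, Fin.cons_succ, Fin.val_zero]
    ring

theorem norm_sum_lt_card {ι : Type*} [DecidableEq ι] {s : Finset ι} {f : ι → ℂ}
    (hf : ∀ i ∈ s, ‖f i‖ = 1) {x y : ι} (hx : x ∈ s) (hy : y ∈ s) (hxy : f x ≠ f y) :
    ‖∑ i ∈ s, f i‖ < s.card := by
  have hne : y ≠ x := fun h => hxy (h ▸ rfl)
  have hy' : y ∈ s.erase x := Finset.mem_erase.mpr ⟨hne, hy⟩
  have hrest : ‖∑ i ∈ (s.erase x).erase y, f i‖ ≤ ((s.erase x).erase y).card := by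
    refine (norm_sum_le _ _).trans (le_of_eq ?_)
    rw [Finset.sum_congr rfl fun i hi => hf i (Finset.mem_of_mem_erase (Finset.mem_of_mem_erase hi))]
    simp
  have hpair : ‖f x + f y‖ < 2 := by
    refine lt_of_le_of_ne ((norm_add_le _ _).trans (by rw [hf x hx, hf y hy]; norm_num)) ?_
    intro h
    refine hxy (eq_of_norm_eq_of_norm_add_eq ((hf x hx).trans (hf y hy).symm) ?_)
    rw [h, hf x hx, hf y hy]
    norm_num
  have hcard : (s.card : ℝ) = ((s.erase x).erase y).card + 2 := by
    rw [← Finset.card_erase_add_one hx, ← Finset.card_erase_add_one hy']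
    push_cast
    ring
  rw [← Finset.add_sum_erase _ _ hx, ← Finset.add_sum_erase _ _ hy', ← add_assoc, hcard]
  linarith [norm_add_le (f x + f y) (∑ i ∈ (s.erase x).erase y, f i)]

/-- The character `l ↦ exp(-2πi m l / N)` of `Z_N`. -/
noncomputable def dftChar (N m l : ℕ) : ℂ :=
  Complex.exp (-(2 * (Real.pi : ℂ) * Complex.I * m * l) / N)

theorem norm_dftChar (N m l : ℕ) : ‖dftChar N m l‖ = 1 := by
  have h : -(2 * (Real.pi : ℂ) * Complex.I * m * l) / N
      = ((-(2 * Real.pi * m * l) / N : ℝ) : ℂ) * Complex.I := by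
    push_cast
    ring
  rw [dftChar, h, Complex.norm_exp_ofReal_mul_I]

theorem dvd_of_dftChar_eq {N m x d : ℕ} (hN : N ≠ 0)
    (h : dftChar N m x = dftChar N m (x + d)) : N ∣ m * d := by
  obtain ⟨n, hn⟩ := Complex.exp_eq_exp_iff_exists_int.mp h
  have hN' : (N : ℂ) ≠ 0 := Nat.cast_ne_zero.mpr hN
  have key : (m * d : ℂ) = N * n := by
    field_simp at hn
    push_cast at hn
    linear_combination hn
  exact Int.natCast_dvd_natCast.mp ⟨n, by exact_mod_cast key⟩

theorem norm_dftInd_sq {N : ℕ} {S : Finset ℕ} (hS : S ⊆ Finset.range N) (m : ℕ) :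
    ‖dftInd N S m‖ ^ 2 = ‖∑ l ∈ S, dftChar N m l‖ ^ 2 / N := by
  have hsum : ∑ l ∈ Finset.range N, (if l ∈ S then (1 : ℂ) else 0) *
      Complex.exp (-(2 * (Real.pi : ℂ) * Complex.I * m * l) / N) = ∑ l ∈ S, dftChar N m l := by
    simp only [ite_mul, one_mul, zero_mul, Finset.sum_ite_mem, dftChar,
      Finset.inter_eq_right.mpr hS]
  rw [dftInd, hsum, norm_mul, mul_pow, Complex.norm_real, Real.norm_eq_abs, sq_abs, div_pow,
    Real.sq_sqrt (Nat.cast_nonneg N)]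
  ring

theorem tk_eq_sum {M : ℕ} {A : Finset ℕ} (hA : A ⊆ Finset.range M) (k : ℕ) :
    tk M A k = (∑ p ∈ Ck M A k ×ˢ Ck M A k,
      ‖∑ x ∈ Ck M A k, dftChar (M ^ k) (p.2 + M ^ k - p.1) x‖ ^ 2) / ((M ^ k : ℕ) : ℝ) ^ 2 := by
  have hS := Ck_subset_range hA k
  simp only [tk, norm_dftInd_sq hS, mul_assoc, ← Finset.mul_sum]
  simp only [ite_mul, one_mul, zero_mul, Finset.sum_ite_mem, Finset.inter_eq_right.mpr hS,
    Finset.sum_product, ← Finset.sum_div]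
  ring

/-- If `|A| ≥ 2`, then for every `k ≥ 2` the inequality
`t_k ≤ |C_k|⁴/N²` is strict: `t_k < |A|^{4k} / M^{2k}`. -/
theorem stmt7 (M : ℕ) (hM : 2 ≤ M) (A : Finset ℕ) (hA : A ⊆ Finset.range M)
    (hA2 : 2 ≤ A.card) (k : ℕ) (hk : 2 ≤ k) :
    tk M A k < (A.card : ℝ) ^ (4 * k) / (M : ℝ) ^ (2 * k) := by
  obtain ⟨a, ha, b, hb, hab⟩ : ∃ a ∈ A, ∃ b ∈ A, a < b := by
    obtain ⟨a, ha, b, hb, hne⟩ := Finset.one_lt_card.mp hA2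
    rcases hne.lt_or_gt with h | h
    exacts [⟨a, ha, b, hb, h⟩, ⟨b, hb, a, ha, h⟩]
  obtain ⟨d, rfl⟩ := Nat.exists_eq_add_of_le hab.le
  have hd0 : 0 < d := by omega
  have hdM : d < M := by
    have := Finset.mem_range.mp (hA hb)
    omega
  have hN : 0 < M ^ k := by positivity
  obtain ⟨j, hj, hjd⟩ := exists_add_mem_Ck (M := M) ha hb (k := k) (by omega)
  have hdvd : ¬ M ^ k ∣ (d + M ^ k) * d := by
    rw [add_mul, Nat.dvd_add_left (Dvd.intro _ rfl)]
    refine Nat.not_dvd_of_pos_of_lt (by positivity) ?_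
    calc d * d < M * M := Nat.mul_lt_mul'' hdM hdM
      _ = M ^ 2 := (sq M).symm
      _ ≤ M ^ k := Nat.pow_le_pow_right (by omega) hk
  have hlt : ∑ p ∈ Ck M A k ×ˢ Ck M A k,
      ‖∑ x ∈ Ck M A k, dftChar (M ^ k) (p.2 + M ^ k - p.1) x‖ ^ 2
      < ∑ _p ∈ Ck M A k ×ˢ Ck M A k, ((Ck M A k).card : ℝ) ^ 2 := by
    refine Finset.sum_lt_sum (fun p _ => ?_) ⟨(j, j + d), Finset.mk_mem_product hj hjd, ?_⟩
    · gcongr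
      refine (norm_sum_le _ _).trans (le_of_eq ?_)
      simp [norm_dftChar]
    · gcongr
      refine norm_sum_lt_card (fun _ _ => norm_dftChar _ _ _) hj hjd fun h => hdvd ?_
      have hidx : j + d + M ^ k - j = d + M ^ k := by omega
      exact hidx ▸ dvd_of_dftChar_eq hN.ne' h
  have hcard : ((Ck M A k).card : ℝ) ≤ (A.card : ℝ) ^ k := by
    exact_mod_cast card_Ck_le M A k
  have hden : (((M ^ k : ℕ) : ℝ)) ^ 2 = (M : ℝ) ^ (2 * k) := by
    push_cast
    ring
  rw [tk_eq_sum hA, hden]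
  have hM0 : (0 : ℝ) < (M : ℝ) ^ (2 * k) := by positivity
  refine div_lt_div_of_pos_right (hlt.trans_le ?_) hM0
  calc ∑ _p ∈ Ck M A k ×ˢ Ck M A k, ((Ck M A k).card : ℝ) ^ 2
      = ((Ck M A k).card : ℝ) ^ 4 := by
        simp only [Finset.sum_const, Finset.card_product, nsmul_eq_mul]
        push_cast
        ring
    _ ≤ ((A.card : ℝ) ^ k) ^ 4 := by gcongr
    _ = (A.card : ℝ) ^ (4 * k) := by ring
end

section
/- Let δ ∈ (0,1) and β_F ∈ (0, δ]. Let Λ ⊂ ℝ be a nonempty compact set and μ a Borel probability measure on ℝ with support contained in Λ. Assume: (i) (upper regularity) there is C_R > 0 such that for all x₀ ∈ Λ and all 0 < α ≤ α' ≤ 1, the Lebesgue measure of Λ(α) ∩ [x₀−α', x₀+α'] is at most C_R·α^{1−δ}·(α')^δ, where Λ(α) := {x ∈ ℝ : |x − x'| ≤ α for some x' ∈ Λ}; (ii) (Fourier decay) for every K ≥ 1 there is C_K > 0 such that for all φ ∈ C²(ℝ;ℝ) and g ∈ C¹(ℝ;ℂ) satisfying ‖φ‖_{C²} + ‖g‖_{C¹}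 ≤ K and inf_{x∈Λ}|φ'(x)| ≥ 1/K, and all ξ ∈ ℝ with |ξ| > 1, one has |∫ e^{iξφ(x)} g(x) dμ(x)| ≤ C_K·|ξ|^{−β_F/2}. Fix ρ ∈ (1/2, 1), ρ' ∈ (0,1), c₁, c₂ > 0, and G ∈ C_c^∞(ℝ²) with supp G ∩ {(x,y) : x = y} = ∅. For 0 < h < 1 define F_h(x) := (1/(4h^δ))·μ([x−2h, x+2h]), Φ(x,η) := 2 log|x−η|, K(x,w;h) := ∫_ℝ F_{c₂h^{ρ'}}(η)·exp((i/h)(Φ(x,η) − Φ(w,η)))·G(x,η)·G(w,η) dη, and I(h) := ∬_{Λ(c₁h^ρ)×Λ(c₁h^ρ)} |K(x,w;h)|² dx dw. Then there exist C > 0 and h₀ > 0 such that for all 0 < h < h₀, I(h) ≤ C·h^{2ρ'(1−δ) + 2ρ(1−δ) + β_F/2}. -/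
open scoped BigOperators
open MeasureTheory

/-- The `α`-neighborhood `Λ(α) = {x ∈ ℝ : |x - x'| ≤ α for some x' ∈ Λ}`. -/
def nbhd (Λ : Set ℝ) (α : ℝ) : Set ℝ := {x : ℝ | ∃ x' ∈ Λ, |x - x'| ≤ α}

/-- `F_h(x) = (1/(4 h^δ)) μ([x-2h, x+2h])`. -/
noncomputable def Fmu (μ : Measure ℝ) (δ h x : ℝ) : ℝ :=
  1 / (4 * h ^ δ) * (μ (Set.Icc (x - 2 * h) (x + 2 * h))).toReal

/-- The kernel `K(x,w;h) = ∫ F_{c₂ h^{ρ'}}(η) exp((i/h)(Φ(x,η) - Φ(w,η))) G(x,η) G(w,η) dη`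
with `Φ(x,η) = 2 log|x-η|`. -/
noncomputable def Kker (μ : Measure ℝ) (δ ρ' c₂ : ℝ) (G : ℝ × ℝ → ℝ) (h x w : ℝ) : ℂ :=
  ∫ η : ℝ, ((Fmu μ δ (c₂ * h ^ ρ') η : ℝ) : ℂ) *
    Complex.exp (Complex.I / (h : ℂ) *
      ((2 * Real.log |x - η| - 2 * Real.log |w - η| : ℝ) : ℂ)) *
    ((G (x, η) : ℝ) : ℂ) * ((G (w, η) : ℝ) : ℂ)

/-- `I(h) = ∬_{Λ(c₁ h^ρ)²} |K(x,w;h)|² dx dw`. -/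
noncomputable def Ih (μ : Measure ℝ) (Λ : Set ℝ) (δ ρ ρ' c₁ c₂ : ℝ) (G : ℝ × ℝ → ℝ)
    (h : ℝ) : ℝ :=
  ∫ x in nbhd Λ (c₁ * h ^ ρ), ∫ w in nbhd Λ (c₁ * h ^ ρ),
    ‖Kker μ δ ρ' c₂ G h x w‖ ^ 2

lemma exists_smooth_inv_extension (ε : ℝ) (hε : 0 < ε) :
    ∃ r : ℝ → ℝ, ContDiff ℝ 3 r ∧ (∀ u, 0 < r u) ∧ ∀ u, ε ≤ u → r u = 1 / u := by
  have hm : ∀ u : ℝ, 0 < u * Real.smoothTransition (u / ε)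
      + (1 - Real.smoothTransition (u / ε)) * ε := by
    intro u
    rcases le_or_gt u 0 with hu | hu
    · rw [Real.smoothTransition.zero_of_nonpos (div_nonpos_of_nonpos_of_nonneg hu hε.le)]
      simpa using hε
    · have h0 := Real.smoothTransition.pos_of_pos (div_pos hu hε)
      have h1 := Real.smoothTransition.le_one (u / ε)
      nlinarith [mul_pos hu h0, mul_nonneg (sub_nonneg.2 h1) hε.le]
  refine ⟨fun u => 1 / (u * Real.smoothTransition (u / ε)
      + (1 - Real.smoothTransition (u / ε)) * ε), ?_, fun u => one_div_pos.2 (hm u), ?_⟩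
  · have hs : ContDiff ℝ 3 fun u : ℝ => Real.smoothTransition (u / ε) :=
      Real.smoothTransition.contDiff.comp (contDiff_id.div_const ε)
    exact contDiff_const.div
      ((contDiff_id.mul hs).add ((contDiff_const.sub hs).mul contDiff_const))
      fun u => (hm u).ne'
  · intro u hu
    simp only
    rw [Real.smoothTransition.one_of_one_le ((one_le_div hε).2 hu)]
    simp

lemma exists_norm_le_and_norm_fderiv_le {E : Type*} [NormedAddCommGroup E] [NormedSpace ℝ E]
    {f : E → ℝ} (hf : ContDiff ℝ 1 f) (hs : HasCompactSupport f) :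
    ∃ M : ℝ, 0 < M ∧ (∀ p, |f p| ≤ M) ∧ ∀ p, ‖fderiv ℝ f p‖ ≤ M := by
  obtain ⟨A, hA⟩ := hs.exists_bound_of_continuous hf.continuous
  obtain ⟨B, hB⟩ := (hs.fderiv (𝕜 := ℝ)).exists_bound_of_continuous
    (hf.continuous_fderiv one_ne_zero)
  exact ⟨max 1 (max A B), by positivity,
    fun p => (hA p).trans ((le_max_left _ _).trans (le_max_right _ _)),
    fun p => (hB p).trans ((le_max_right _ _).trans (le_max_right _ _))⟩

lemma exists_phase (ε R σ₁ σ₂ : ℝ) (hε : 0 < ε) (hR : 0 < R) :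
    ∃ K : ℝ, 1 ≤ K ∧ ∀ a b : ℝ, |a| ≤ R → |b| ≤ R → ∃ φ : ℝ → ℝ, ContDiff ℝ 2 φ ∧
      (∀ y, |φ y| + |deriv φ y| + |deriv (deriv φ) y| ≤ K) ∧
      (∀ y, |y| ≤ R → 1 / K ≤ |deriv φ y|) ∧
      ∀ y, |y| ≤ R → ε ≤ σ₁ * (y - a) → ε ≤ σ₂ * (y - b) →
        deriv φ y = 2 / ((σ₁ * (y - a)) * (σ₂ * (y - b))) := by
  obtain ⟨r, hr, hrpos, hrinv⟩ := exists_smooth_inv_extension ε hε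
  let χ : ContDiffBump (0 : ℝ) := ⟨R, R + 1, hR, by linarith⟩
  have hχ1 : ∀ y : ℝ, |y| ≤ R → χ y = 1 := fun y hy =>
    χ.one_of_mem_closedBall (by simpa [χ] using hy)
  have hχ0 : ∀ y : ℝ, R + 1 ≤ |y| → χ y = 0 := fun y hy =>
    χ.zero_of_le_dist (by simpa [χ] using hy)
  have hχd : ContDiff ℝ 1 χ := χ.contDiff
  let Θ : ℝ × ℝ × ℝ → ℝ := fun p =>
    2 * r (σ₁ * (p.2.2 - p.1)) * r (σ₂ * (p.2.2 - p.2.1)) * (χ p.1 * χ p.2.1 * χ p.2.2)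
  have hΘ : ContDiff ℝ 1 Θ := by
    have hr1 : ContDiff ℝ 1 r := hr.of_le (by norm_num)
    have h1 : ContDiff ℝ 1 fun p : ℝ × ℝ × ℝ => r (σ₁ * (p.2.2 - p.1)) :=
      hr1.comp (by fun_prop)
    have h2 : ContDiff ℝ 1 fun p : ℝ × ℝ × ℝ => r (σ₂ * (p.2.2 - p.2.1)) :=
      hr1.comp (by fun_prop)
    have h3 : ContDiff ℝ 1 fun p : ℝ × ℝ × ℝ => χ p.1 := hχd.comp (by fun_prop)
    have h4 : ContDiff ℝ 1 fun p : ℝ × ℝ × ℝ => χ p.2.1 := hχd.comp (by fun_prop)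
    have h5 : ContDiff ℝ 1 fun p : ℝ × ℝ × ℝ => χ p.2.2 := hχd.comp (by fun_prop)
    exact ((contDiff_const.mul h1).mul h2).mul ((h3.mul h4).mul h5)
  have hΘ0 : ∀ p, p ∉ Set.Icc (-(R + 1)) (R + 1) ×ˢ Set.Icc (-(R + 1)) (R + 1) ×ˢ
      Set.Icc (-(R + 1)) (R + 1) → Θ p = 0 := by
    intro p hp
    by_contra hne
    apply hp
    have key : ∀ u : ℝ, χ u ≠ 0 → u ∈ Set.Icc (-(R + 1)) (R + 1) := fun u hu =>
      by
      rw [Set.mem_Icc, ← abs_le]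
      by_contra hlt
      exact hu (hχ0 u (not_le.1 hlt).le)
    refine ⟨key _ ?_, key _ ?_, key _ ?_⟩ <;> intro h0 <;> exact hne (by simp [Θ, h0])
  have hΘs : HasCompactSupport Θ :=
    HasCompactSupport.intro (isCompact_Icc.prod (isCompact_Icc.prod isCompact_Icc)) hΘ0
  obtain ⟨M, hM, hM1, hM2⟩ := exists_norm_le_and_norm_fderiv_le hΘ hΘs
  obtain ⟨q, hq, hqmin⟩ := (isCompact_Icc.prod (isCompact_Icc.prod isCompact_Icc) :
      IsCompact (Set.Icc (-R) R ×ˢ Set.Icc (-R) R ×ˢ Set.Icc (-R) R)).exists_isMinOn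
    ⟨(0, 0, 0), by simp [hR.le]⟩ hΘ.continuous.continuousOn
  have hval : ∀ a b y : ℝ, |a| ≤ R → |b| ≤ R → |y| ≤ R →
      Θ (a, b, y) = 2 * r (σ₁ * (y - a)) * r (σ₂ * (y - b)) := by
    intro a b y ha hb hy
    simp [Θ, hχ1 a ha, hχ1 b hb, hχ1 y hy]
  have hqpos : 0 < Θ q := by
    obtain ⟨a, b, y⟩ := q
    rw [hval a b y (abs_le.2 hq.1) (abs_le.2 hq.2.1) (abs_le.2 hq.2.2)]
    exact mul_pos (mul_pos two_pos (hrpos _)) (hrpos _)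
  refine ⟨max 1 (max (M * (2 * (R + 1)) + M + M) (1 / Θ q)), le_max_left _ _, ?_⟩
  intro a b ha hb
  have hc : Continuous fun z : ℝ => Θ (a, b, z) := hΘ.continuous.comp (by fun_prop)
  have hderiv : deriv (fun y : ℝ => ∫ z in (0 : ℝ)..y, Θ (a, b, z)) = fun y => Θ (a, b, y) := by
    funext y
    exact intervalIntegral.deriv_integral_right (hc.intervalIntegrable _ _)
      hc.stronglyMeasurable.stronglyMeasurableAtFilter hc.continuousAt
  have hΘ' : ∀ y, HasDerivAt (fun y => Θ (a, b, y)) (fderiv ℝ Θ (a, b, y) (0, 0, 1)) y := by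
    intro y
    have h1 : HasFDerivAt Θ (fderiv ℝ Θ (a, b, y)) (a, b, y) :=
      (hΘ.differentiable one_ne_zero _).hasFDerivAt
    exact h1.comp_hasDerivAt y
      ((hasDerivAt_const y a).prodMk ((hasDerivAt_const y b).prodMk (hasDerivAt_id y)))
  refine ⟨fun y => ∫ z in (0 : ℝ)..y, Θ (a, b, z), ?_, ?_, ?_, ?_⟩
  · rw [show (2 : WithTop ℕ∞) = 1 + 1 by norm_num, contDiff_succ_iff_deriv, hderiv]
    refine ⟨fun y => ?_, by simp, hΘ.comp (by fun_prop)⟩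
    exact (intervalIntegral.integral_hasDerivAt_right (hc.intervalIntegrable _ _)
      hc.stronglyMeasurable.stronglyMeasurableAtFilter hc.continuousAt).differentiableAt
  · intro y
    rw [hderiv, (hΘ' y).deriv]
    have hle : |∫ z in (0 : ℝ)..y, Θ (a, b, z)| ≤ M * (2 * (R + 1)) := by
      have hind : ∀ z, ‖Θ (a, b, z)‖
          ≤ (Set.Icc (-(R + 1)) (R + 1)).indicator (fun _ => M) z := by
        intro z
        by_cases hz : z ∈ Set.Icc (-(R + 1)) (R + 1)
        · rw [Set.indicator_of_mem hz]
          exact hM1 _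
        · rw [Set.indicator_of_notMem hz, hΘ0 _ (fun h => hz h.2.2), norm_zero]
      have hInt : Integrable ((Set.Icc (-(R + 1)) (R + 1)).indicator fun _ : ℝ => M) := by
        rw [integrable_indicator_iff measurableSet_Icc]
        exact continuous_const.integrableOn_Icc
      calc |∫ z in (0 : ℝ)..y, Θ (a, b, z)|
          ≤ ∫ z in Set.uIoc 0 y, ‖Θ (a, b, z)‖ := by
            rw [← Real.norm_eq_abs]
            exact intervalIntegral.norm_integral_le_integral_norm_uIoc
        _ ≤ ∫ z in Set.uIoc 0 y, (Set.Icc (-(R + 1)) (R + 1)).indicator (fun _ => M) z :=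
            integral_mono_of_nonneg (Filter.Eventually.of_forall fun _ => norm_nonneg _)
              hInt.integrableOn (Filter.Eventually.of_forall hind)
        _ ≤ ∫ z, (Set.Icc (-(R + 1)) (R + 1)).indicator (fun _ => M) z :=
            setIntegral_le_integral hInt (Filter.Eventually.of_forall fun z =>
              Set.indicator_nonneg (fun _ _ => hM.le) z)
        _ = M * (2 * (R + 1)) := by
            rw [integral_indicator_const _ measurableSet_Icc]
            simp only [Measure.real, Real.volume_Icc, smul_eq_mul]
            rw [ENNReal.toReal_ofReal (by linarith)]
            ring
    have h2 : |fderiv ℝ Θ (a, b, y) (0, 0, 1)| ≤ M := by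
      have hn : ‖((0 : ℝ), (0 : ℝ), (1 : ℝ))‖ = 1 := by simp [Prod.norm_def]
      have := (fderiv ℝ Θ (a, b, y)).le_of_opNorm_le (hM2 _) (0, 0, 1)
      rwa [hn, mul_one] at this
    calc _ ≤ M * (2 * (R + 1)) + M + M := add_le_add (add_le_add hle (hM1 _)) h2
      _ ≤ _ := (le_max_left _ _).trans (le_max_right _ _)
  · intro y hy
    rw [hderiv]
    have h1 : Θ q ≤ Θ (a, b, y) := hqmin ⟨abs_le.1 ha, abs_le.1 hb, abs_le.1 hy⟩
    calc 1 / max 1 (max (M * (2 * (R + 1)) + M + M) (1 / Θ q)) ≤ 1 / (1 / Θ q) :=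
          one_div_le_one_div_of_le (by positivity) ((le_max_right _ _).trans (le_max_right _ _))
      _ = Θ q := one_div_one_div _
      _ ≤ _ := h1.trans (le_abs_self _)
  · intro y hy h1 h2
    rw [hderiv]
    simp only
    rw [hval a b y ha hb hy, hrinv _ h1, hrinv _ h2]
    have : σ₁ * (y - a) ≠ 0 := by linarith
    have : σ₂ * (y - b) ≠ 0 := by linarith
    field_simp

lemma log_phase_sub_const {R ε σ₁ σ₂ a b : ℝ} (hε : 0 < ε) (h₁ : σ₁ ^ 2 = 1) (h₂ : σ₂ ^ 2 = 1)
    {φ : ℝ → ℝ} (hφ : Differentiable ℝ φ)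
    (hd : ∀ y, |y| ≤ R → ε ≤ σ₁ * (y - a) → ε ≤ σ₂ * (y - b) →
        deriv φ y = 2 / ((σ₁ * (y - a)) * (σ₂ * (y - b)))) :
    ∃ c : ℝ, ∀ y, |y| ≤ R → ε ≤ σ₁ * (y - a) → ε ≤ σ₂ * (y - b) →
      2 * Real.log |a - y| - 2 * Real.log |b - y| = (a - b) * (σ₁ * σ₂) * φ y + c := by
  let J : Set ℝ := {y | |y| ≤ R ∧ ε ≤ σ₁ * (y - a) ∧ ε ≤ σ₂ * (y - b)}
  have hJ : Convex ℝ J := by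
    rintro y ⟨hy1, hy2, hy3⟩ z ⟨hz1, hz2, hz3⟩ s t hs ht hst
    rw [abs_le] at hy1 hz1
    obtain rfl : t = 1 - s := by linarith
    refine ⟨abs_le.2 ⟨?_, ?_⟩, ?_, ?_⟩ <;> simp only [smul_eq_mul] <;> nlinarith
  let D : ℝ → ℝ := fun y =>
    2 * Real.log (a - y) - 2 * Real.log (b - y) - (a - b) * (σ₁ * σ₂) * φ y
  have hD : ∀ y ∈ J, HasDerivWithinAt D 0 J y := by
    rintro y ⟨hy1, hy2, hy3⟩
    have ha : a - y ≠ 0 := fun h0 => by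
      rw [show y - a = 0 by linarith] at hy2
      linarith
    have hb : b - y ≠ 0 := fun h0 => by
      rw [show y - b = 0 by linarith] at hy3
      linarith
    have e1 := ((hasDerivAt_id y).const_sub a).log ha
    have e2 := ((hasDerivAt_id y).const_sub b).log hb
    have e3 := ((e1.const_mul 2).sub (e2.const_mul 2)).sub
      ((hφ y).hasDerivAt.const_mul ((a - b) * (σ₁ * σ₂)))
    refine HasDerivAt.hasDerivWithinAt (e3.congr_deriv ?_)
    rw [hd y hy1 hy2 hy3]
    have ha' : y - a ≠ 0 := fun h0 => ha (by linarith)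
    have hb' : y - b ≠ 0 := fun h0 => hb (by linarith)
    have hs1 : σ₁ ≠ 0 := fun h0 => by simp [h0] at h₁
    have hs2 : σ₂ ≠ 0 := fun h0 => by simp [h0] at h₂
    simp only [id]
    rw [show a - y = -(y - a) by ring, show b - y = -(y - b) by ring]
    field_simp
    ring
  have hconst : ∀ y ∈ J, ∀ z ∈ J, D y = D z := by
    intro y hy z hz
    have := hJ.norm_image_sub_le_of_norm_hasDerivWithin_le hD (C := 0) (by simp) hz hy
    rw [zero_mul] at this
    exact sub_eq_zero.1 (norm_le_zero_iff.1 this)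
  rcases J.eq_empty_or_nonempty with hem | ⟨z, hz⟩
  · refine ⟨0, fun y hy1 hy2 hy3 => ?_⟩
    have : y ∈ J := ⟨hy1, hy2, hy3⟩
    simp [hem] at this
  · refine ⟨D z, fun y hy1 hy2 hy3 => ?_⟩
    rw [← hconst y ⟨hy1, hy2, hy3⟩ z hz]
    simp only [Real.log_abs, D]
    ring

lemma exists_amplitude_bound {P Q : ℝ × ℝ → ℝ} (hP : ContDiff ℝ 1 P) (hPs : HasCompactSupport P)
    (hQ : ContDiff ℝ 1 Q) (hQs : HasCompactSupport Q) :
    ∃ M : ℝ, 0 < M ∧ ∀ x w t : ℝ,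
      ContDiff ℝ 1 (fun y : ℝ => ((P (x, y + t) * Q (w, y + t) : ℝ) : ℂ)) ∧
      ∀ y, ‖((P (x, y + t) * Q (w, y + t) : ℝ) : ℂ)‖ +
        ‖deriv (fun y : ℝ => ((P (x, y + t) * Q (w, y + t) : ℝ) : ℂ)) y‖ ≤ M := by
  obtain ⟨A, hA, hA1, hA2⟩ := exists_norm_le_and_norm_fderiv_le hP hPs
  obtain ⟨B, hB, hB1, hB2⟩ := exists_norm_le_and_norm_fderiv_le hQ hQs
  have key : ∀ {F : ℝ × ℝ → ℝ} {M : ℝ}, ContDiff ℝ 1 F → (∀ p, ‖fderiv ℝ F p‖ ≤ M) →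
      ∀ x t y : ℝ, ∃ d, HasDerivAt (fun y => F (x, y + t)) d y ∧ |d| ≤ M := by
    intro F M hF hM x t y
    have h1 : HasFDerivAt F (fderiv ℝ F (x, y + t)) (x, y + t) :=
      (hF.differentiable one_ne_zero _).hasFDerivAt
    refine ⟨fderiv ℝ F (x, y + t) (0, 1), h1.comp_hasDerivAt y
      ((hasDerivAt_const y x).prodMk ((hasDerivAt_id y).add_const t)), ?_⟩
    have hn : ‖((0 : ℝ), (1 : ℝ))‖ = 1 := by simp [Prod.norm_def]
    have := (fderiv ℝ F (x, y + t)).le_of_opNorm_le (hM _) (0, 1)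
    rwa [hn, mul_one] at this
  refine ⟨A * B + (A * B + A * B), by positivity, fun x w t => ⟨?_, fun y => ?_⟩⟩
  · have e1 : ContDiff ℝ 1 fun y : ℝ => P (x, y + t) := hP.comp (by fun_prop)
    have e2 : ContDiff ℝ 1 fun y : ℝ => Q (w, y + t) := hQ.comp (by fun_prop)
    exact Complex.ofRealCLM.contDiff.comp (e1.mul e2)
  · obtain ⟨d, hd, hdA⟩ := key hP hA2 x t y
    obtain ⟨e, he, heB⟩ := key hQ hB2 w t y
    have hde : HasDerivAt (fun y : ℝ => ((P (x, y + t) * Q (w, y + t) : ℝ) : ℂ)) _ y :=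
      (hd.mul he).ofReal_comp
    rw [hde.deriv, Complex.norm_real, Complex.norm_real,
      Real.norm_eq_abs, Real.norm_eq_abs]
    gcongr
    · rw [abs_mul]
      exact mul_le_mul (hA1 _) (hB1 _) (abs_nonneg _) hA.le
    · refine (abs_add_le _ _).trans ?_
      rw [abs_mul, abs_mul]
      exact add_le_add (mul_le_mul hdA (hB1 _) (abs_nonneg _) hA.le)
        (mul_le_mul (hA1 _) heB (abs_nonneg _) hA.le)

/-- The oscillating factor `exp((i/h)(2 log|x-η| - 2 log|w-η|))` of the kernel `Kker`. -/
noncomputable def logPhase (h x w η : ℝ) : ℂ :=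
  Complex.exp (Complex.I / (h : ℂ) *
    ((2 * Real.log |x - η| - 2 * Real.log |w - η| : ℝ) : ℂ))

lemma norm_logPhase (h x w η : ℝ) : ‖logPhase h x w η‖ = 1 := by
  rw [logPhase, Complex.norm_exp]
  have : (Complex.I / (h : ℂ) *
    ((2 * Real.log |x - η| - 2 * Real.log |w - η| : ℝ) : ℂ)).re = 0 := by
    rw [Complex.re_mul_ofReal, Complex.div_ofReal_re]
    simp
  rw [this, Real.exp_zero]

lemma measurable_logPhase (h x w : ℝ) : Measurable (logPhase h x w) := by
  unfold logPhase
  fun_prop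

lemma oscillatory_integral_bound {βF : ℝ} {Λ : Set ℝ} {μ : Measure ℝ} (hsupp : μ Λᶜ = 0)
    (hFourier : ∀ K : ℝ, 1 ≤ K → ∃ C_K : ℝ, 0 < C_K ∧
      ∀ (φ : ℝ → ℝ) (g : ℝ → ℂ), ContDiff ℝ 2 φ → ContDiff ℝ 1 g →
        (∀ x : ℝ, |φ x| + |deriv φ x| + |deriv (deriv φ) x| + ‖g x‖ + ‖deriv g x‖ ≤ K) →
        (∀ x ∈ Λ, 1 / K ≤ |deriv φ x|) →
        ∀ ξ : ℝ, 1 < |ξ| →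
          ‖∫ x : ℝ, Complex.exp (Complex.I * (ξ : ℂ) * ((φ x : ℝ) : ℂ)) * g x ∂μ‖
            ≤ C_K * |ξ| ^ (-βF / 2))
    {R ε σ₁ σ₂ : ℝ} (hR : 0 < R) (hΛR : ∀ y ∈ Λ, |y| ≤ R) (hε : 0 < ε)
    (h₁ : σ₁ ^ 2 = 1) (h₂ : σ₂ ^ 2 = 1)
    {P Q : ℝ × ℝ → ℝ} (hP : ContDiff ℝ 1 P) (hPs : HasCompactSupport P)
    (hQ : ContDiff ℝ 1 Q) (hQs : HasCompactSupport Q)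
    (hPσ : ∀ p, P p ≠ 0 → ε ≤ σ₁ * (p.2 - p.1)) (hQσ : ∀ p, Q p ≠ 0 → ε ≤ σ₂ * (p.2 - p.1)) :
    ∃ C : ℝ, 0 < C ∧ ∀ x w t h : ℝ, |x - t| ≤ R → |w - t| ≤ R → 0 < h → h < |x - w| →
      ‖∫ y : ℝ, logPhase h x w (y + t) *
          ((P (x, y + t) * Q (w, y + t) : ℝ) : ℂ) ∂μ‖ ≤ C * (|x - w| / h) ^ (-βF / 2) := by
  obtain ⟨K, hK, hphase⟩ := exists_phase ε R σ₁ σ₂ hε hR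
  obtain ⟨M, hM, hamp⟩ := exists_amplitude_bound hP hPs hQ hQs
  obtain ⟨C, hC, hdecay⟩ := hFourier (K + M) (by linarith)
  refine ⟨C, hC, fun x w t h hx hw hh hxw => ?_⟩
  obtain ⟨φ, hφ, hφK, hφl, hφd⟩ := hphase (x - t) (w - t) hx hw
  obtain ⟨c, hc⟩ := log_phase_sub_const hε h₁ h₂ (hφ.differentiable two_ne_zero) hφd
  obtain ⟨hg, hgM⟩ := hamp x w t
  have hσ : |σ₁ * σ₂| = 1 := by
    rcases sq_eq_one_iff.1 h₁ with rfl | rfl <;> rcases sq_eq_one_iff.1 h₂ with rfl | rfl <;> simp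
  have hξ : |(x - w) * (σ₁ * σ₂) / h| = |x - w| / h := by
    rw [abs_div, abs_mul, hσ, mul_one, abs_of_pos hh]
  have hmain := hdecay φ _ hφ hg
    (fun y => by have := hφK y; have := hgM y; linarith)
    (fun y hy => (one_div_le_one_div_of_le (by linarith) (by linarith)).trans (hφl y (hΛR y hy)))
    ((x - w) * (σ₁ * σ₂) / h) (by rw [hξ]; exact (one_lt_div hh).2 hxw)
  rw [hξ] at hmain
  refine le_trans (le_of_eq ?_) hmain
  have hΛae : ∀ᵐ y ∂μ, y ∈ Λ := by rwa [ae_iff]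
  have heq : ∀ᵐ y ∂μ, logPhase h x w (y + t) *
          ((P (x, y + t) * Q (w, y + t) : ℝ) : ℂ) =
      Complex.exp (((c / h : ℝ) : ℂ) * Complex.I) *
        (Complex.exp (Complex.I * (((x - w) * (σ₁ * σ₂) / h : ℝ) : ℂ) * ((φ y : ℝ) : ℂ)) *
          ((P (x, y + t) * Q (w, y + t) : ℝ) : ℂ)) := by
    filter_upwards [hΛae] with y hy
    by_cases h0 : P (x, y + t) * Q (w, y + t) = 0
    · rw [h0]
      simp
    · have hp := hPσ _ (left_ne_zero_of_mul h0)
      have hq := hQσ _ (right_ne_zero_of_mul h0)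
      have := hc y (hΛR y hy) (by convert hp using 2; ring) (by convert hq using 2; ring)
      rw [logPhase, show x - (y + t) = x - t - y by ring, show w - (y + t) = w - t - y by ring, this,
        ← mul_assoc (Complex.exp _) (Complex.exp _), ← Complex.exp_add]
      congr 2
      push_cast
      have : (h : ℂ) ≠ 0 := by exact_mod_cast hh.ne'
      field_simp
      ring
  rw [integral_congr_ae heq, integral_const_mul, norm_mul, Complex.norm_exp_ofReal_mul_I, one_mul]

lemma norm_integral_Fmu_mul_le {μ : Measure ℝ} [IsProbabilityMeasure μ] {δ H A M : ℝ}
    (hH : 0 < H) {f : ℝ → ℂ} (hf : Measurable f) (hfi : Integrable f) (hM : ∀ η, ‖f η‖ ≤ M)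
    (hA : ∀ t, |t| ≤ 2 * H → ‖∫ y, f (y + t) ∂μ‖ ≤ A) :
    ‖∫ η, ((Fmu μ δ H η : ℝ) : ℂ) * f η‖ ≤ H ^ (1 - δ) * A := by
  let S : Set (ℝ × ℝ) := {p | |p.2 - p.1| ≤ 2 * H}
  have hS : MeasurableSet S :=
    (isClosed_le (f := fun p : ℝ × ℝ => |p.2 - p.1|) (by fun_prop) (by fun_prop)).measurableSet
  let k : ℝ → ℝ → ℂ := fun η y => S.indicator (fun p => f p.1) (η, y)
  have hk : Integrable (Function.uncurry k) (volume.prod μ) := by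
    have := (hfi.comp_fst μ).indicator hS
    exact this
  have hk1 : ∀ η, ∫ y, k η y ∂μ = ((μ (Set.Icc (η - 2 * H) (η + 2 * H))).toReal : ℂ) * f η := by
    intro η
    have : k η = (Set.Icc (η - 2 * H) (η + 2 * H)).indicator fun _ => f η := by
      funext y
      simp only [k, Set.indicator, S, Set.mem_ofPred_eq, Set.mem_Icc, abs_le]
      refine if_congr ⟨fun h => ⟨?_, ?_⟩, fun h => ⟨?_, ?_⟩⟩ rfl rfl <;> linarith [h.1, h.2]
    rw [this, integral_indicator_const _ measurableSet_Icc, Complex.real_smul]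
    rfl
  have hk2 : ∀ y, ∫ η, k η y = ∫ t in Set.Icc (-(2 * H)) (2 * H), f (y + t) := by
    intro y
    rw [← integral_add_left_eq_self (fun η => k η y) y, ← integral_indicator measurableSet_Icc]
    congr 1
    funext t
    simp only [k, Set.indicator, S, Set.mem_ofPred_eq, Set.mem_Icc, abs_le]
    refine if_congr ⟨fun h => ⟨?_, ?_⟩, fun h => ⟨?_, ?_⟩⟩ rfl rfl <;> linarith [h.1, h.2]
  have hswap : ∫ η, ((μ (Set.Icc (η - 2 * H) (η + 2 * H))).toReal : ℂ) * f η =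
      ∫ t in Set.Icc (-(2 * H)) (2 * H), ∫ y, f (y + t) ∂μ := by
    simp_rw [← hk1]
    rw [integral_integral_swap hk]
    simp_rw [hk2]
    refine integral_integral_swap ?_
    have hm : Measurable (Function.uncurry fun y t : ℝ => f (y + t)) :=
      hf.comp (measurable_fst.add measurable_snd)
    have : IsFiniteMeasure (volume.restrict (Set.Icc (-(2 * H)) (2 * H))) :=
      ⟨by simp⟩
    exact Integrable.of_bound hm.aestronglyMeasurable M
      (Filter.Eventually.of_forall fun p => hM _)
  have hF : ∫ η, ((Fmu μ δ H η : ℝ) : ℂ) * f η =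
      ((1 / (4 * H ^ δ) : ℝ) : ℂ) *
        ∫ t in Set.Icc (-(2 * H)) (2 * H), ∫ y, f (y + t) ∂μ := by
    rw [← hswap, ← integral_const_mul]
    congr 1
    funext η
    simp only [Fmu]
    push_cast
    ring
  rw [hF, norm_mul, Complex.norm_real, Real.norm_of_nonneg (by positivity)]
  have hb : ‖∫ t in Set.Icc (-(2 * H)) (2 * H), ∫ y, f (y + t) ∂μ‖ ≤ A * (4 * H) := by
    have := norm_setIntegral_le_of_norm_le_const (μ := volume) (s := Set.Icc (-(2 * H)) (2 * H))
      (f := fun t => ∫ y, f (y + t) ∂μ) (C := A) (by simp)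
      (fun t ht => hA t (abs_le.2 ht))
    rw [Real.volume_real_Icc_of_le (by linarith)] at this
    convert this using 2
    ring
  calc 1 / (4 * H ^ δ) * _ ≤ 1 / (4 * H ^ δ) * (A * (4 * H)) := by gcongr
    _ = H ^ (1 - δ) * A := by
      rw [Real.rpow_sub hH, Real.rpow_one]
      have : H ^ δ ≠ 0 := (Real.rpow_pos_of_pos hH δ).ne'
      field_simp

lemma exists_diagonal_gap {G : ℝ × ℝ → ℝ} (hGsupp : HasCompactSupport G)
    (hGdiag : ∀ p : ℝ × ℝ, p ∈ tsupport G → p.1 ≠ p.2) :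
    ∃ ε : ℝ, 0 < ε ∧ ∀ p, G p ≠ 0 → ε ≤ |p.2 - p.1| := by
  obtain ⟨ε, hε, h⟩ := hGsupp.isCompact.exists_forall_le' (f := fun p : ℝ × ℝ => |p.2 - p.1|)
    (a := 0) (by fun_prop) fun p hp => abs_pos.2 (sub_ne_zero.2 (hGdiag p hp).symm)
  exact ⟨ε, hε, fun p hp => h p (subset_tsupport G hp)⟩

lemma exists_sign_splitting {G : ℝ × ℝ → ℝ} (hG : ContDiff ℝ 1 G) (hGsupp : HasCompactSupport G)
    (hGdiag : ∀ p : ℝ × ℝ, p ∈ tsupport G → p.1 ≠ p.2) :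
    ∃ ε : ℝ, 0 < ε ∧ ∃ G₁ G₂ : ℝ × ℝ → ℝ, (∀ p, G p = G₁ p + G₂ p) ∧
      ContDiff ℝ 1 G₁ ∧ ContDiff ℝ 1 G₂ ∧ HasCompactSupport G₁ ∧ HasCompactSupport G₂ ∧
      (∀ p, G₁ p ≠ 0 → ε ≤ 1 * (p.2 - p.1)) ∧ ∀ p, G₂ p ≠ 0 → ε ≤ -1 * (p.2 - p.1) := by
  obtain ⟨ε, hε, hgap⟩ := exists_diagonal_gap hGsupp hGdiag
  let s : ℝ → ℝ × ℝ → ℝ := fun σ p => Real.smoothTransition (σ * (p.2 - p.1) / ε)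
  have hs : ∀ σ, ContDiff ℝ 1 (s σ) := fun σ =>
    Real.smoothTransition.contDiff.comp (by fun_prop)
  have hs0 : ∀ σ p, s σ p ≠ 0 → 0 < σ * (p.2 - p.1) := by
    intro σ p h0
    by_contra hle
    exact h0 (Real.smoothTransition.zero_of_nonpos
      (div_nonpos_of_nonpos_of_nonneg (not_lt.1 hle) hε.le))
  have hs1 : ∀ σ p, ε ≤ σ * (p.2 - p.1) → s σ p = 1 := fun σ p hp =>
    Real.smoothTransition.one_of_one_le ((one_le_div hε).2 hp)
  refine ⟨ε, hε, fun p => G p * s 1 p, fun p => G p * s (-1) p, fun p => ?_, hG.mul (hs _),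
    hG.mul (hs _), hGsupp.mul_right, hGsupp.mul_right, fun p hp => ?_, fun p hp => ?_⟩
  · by_cases h0 : G p = 0
    · simp [h0]
    · have hz : ∀ σ, σ * (p.2 - p.1) ≤ 0 → s σ p = 0 := fun σ hle => by
        by_contra h
        exact (hs0 σ p h).not_ge hle
      change G p = G p * s 1 p + G p * s (-1) p
      rcases le_abs.1 (hgap p h0) with h | h
      · rw [hs1 1 p (by linarith), hz (-1) (by linarith)]
        ring
      · rw [hs1 (-1) p (by linarith), hz 1 (by linarith)]
        ring
  · have h1 := hgap p (left_ne_zero_of_mul hp)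
    have h2 := hs0 _ p (right_ne_zero_of_mul hp)
    rw [one_mul] at h2 ⊢
    rwa [abs_of_pos h2] at h1
  · have h1 := hgap p (left_ne_zero_of_mul hp)
    have h2 := hs0 _ p (right_ne_zero_of_mul hp)
    rw [abs_of_neg (by linarith)] at h1
    linarith

lemma exists_oscillatory_bound {βF : ℝ} {Λ : Set ℝ} {μ : Measure ℝ} [IsProbabilityMeasure μ]
    (hsupp : μ Λᶜ = 0)
    (hFourier : ∀ K : ℝ, 1 ≤ K → ∃ C_K : ℝ, 0 < C_K ∧
      ∀ (φ : ℝ → ℝ) (g : ℝ → ℂ), ContDiff ℝ 2 φ → ContDiff ℝ 1 g →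
        (∀ x : ℝ, |φ x| + |deriv φ x| + |deriv (deriv φ) x| + ‖g x‖ + ‖deriv g x‖ ≤ K) →
        (∀ x ∈ Λ, 1 / K ≤ |deriv φ x|) →
        ∀ ξ : ℝ, 1 < |ξ| →
          ‖∫ x : ℝ, Complex.exp (Complex.I * (ξ : ℂ) * ((φ x : ℝ) : ℂ)) * g x ∂μ‖
            ≤ C_K * |ξ| ^ (-βF / 2))
    {R : ℝ} (hR : 0 < R) (hΛR : ∀ y ∈ Λ, |y| ≤ R)
    {G : ℝ × ℝ → ℝ} (hG : ContDiff ℝ 1 G) (hGsupp : HasCompactSupport G)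
    (hGdiag : ∀ p : ℝ × ℝ, p ∈ tsupport G → p.1 ≠ p.2) :
    ∃ C : ℝ, 0 < C ∧ ∀ x w t h : ℝ, |x - t| ≤ R → |w - t| ≤ R → 0 < h → h < |x - w| →
      ‖∫ y : ℝ, logPhase h x w (y + t) *
          ((G (x, y + t) * G (w, y + t) : ℝ) : ℂ) ∂μ‖ ≤ C * (|x - w| / h) ^ (-βF / 2) := by
  obtain ⟨ε, hε, G₁, G₂, hsum, h1, h2, h1s, h2s, h1σ, h2σ⟩ :=
    exists_sign_splitting hG hGsupp hGdiag
  obtain ⟨C₁, hC₁, b₁⟩ := oscillatory_integral_bound hsupp hFourier hR hΛR hε (by norm_num)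
    (by norm_num) h1 h1s h1 h1s h1σ h1σ
  obtain ⟨C₂, hC₂, b₂⟩ := oscillatory_integral_bound hsupp hFourier hR hΛR hε (by norm_num)
    (by norm_num) h1 h1s h2 h2s h1σ h2σ
  obtain ⟨C₃, hC₃, b₃⟩ := oscillatory_integral_bound hsupp hFourier hR hΛR hε (by norm_num)
    (by norm_num) h2 h2s h1 h1s h2σ h1σ
  obtain ⟨C₄, hC₄, b₄⟩ := oscillatory_integral_bound hsupp hFourier hR hΛR hε (by norm_num)
    (by norm_num) h2 h2s h2 h2s h2σ h2σ
  refine ⟨C₁ + C₂ + C₃ + C₄, by positivity, fun x w t h hx hw hh hxw => ?_⟩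
  have hInt : ∀ {P Q : ℝ × ℝ → ℝ}, ContDiff ℝ 1 P → HasCompactSupport P → ContDiff ℝ 1 Q →
      HasCompactSupport Q → Integrable (fun y => logPhase h x w (y + t) *
        ((P (x, y + t) * Q (w, y + t) : ℝ) : ℂ)) μ := by
    intro P Q hP hPs hQ hQs
    obtain ⟨A, hA⟩ := hPs.exists_bound_of_continuous hP.continuous
    obtain ⟨B, hB⟩ := hQs.exists_bound_of_continuous hQ.continuous
    refine Integrable.of_bound (C := A * B) (Measurable.aestronglyMeasurable ?_)
      (Filter.Eventually.of_forall fun y => ?_)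
    · have hP' := hP.continuous
      have hQ' := hQ.continuous
      exact ((measurable_logPhase h x w).comp (measurable_add_const t)).mul
        (Continuous.measurable (by fun_prop))
    · rw [norm_mul, norm_logPhase, one_mul, Complex.norm_real, norm_mul]
      exact mul_le_mul (hA _) (hB _) (norm_nonneg _) ((norm_nonneg _).trans (hA (x, y + t)))
  have i1 := hInt h1 h1s h1 h1s
  have i2 := hInt h1 h1s h2 h2s
  have i3 := hInt h2 h2s h1 h1s
  have i4 := hInt h2 h2s h2 h2s
  have heq : ∀ y, logPhase h x w (y + t) * ((G (x, y + t) * G (w, y + t) : ℝ) : ℂ) =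
      logPhase h x w (y + t) * ((G₁ (x, y + t) * G₁ (w, y + t) : ℝ) : ℂ) +
      logPhase h x w (y + t) * ((G₁ (x, y + t) * G₂ (w, y + t) : ℝ) : ℂ) +
      logPhase h x w (y + t) * ((G₂ (x, y + t) * G₁ (w, y + t) : ℝ) : ℂ) +
      logPhase h x w (y + t) * ((G₂ (x, y + t) * G₂ (w, y + t) : ℝ) : ℂ) := by
    intro y
    rw [hsum, hsum]
    push_cast
    ring
  simp_rw [heq]
  rw [integral_add (by exact (i1.add i2).add i3) i4, integral_add (by exact i1.add i2) i3,
    integral_add i1 i2]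
  refine norm_add₄_le.trans ?_
  rw [add_mul, add_mul, add_mul]
  exact add_le_add (add_le_add (add_le_add (b₁ x w t h hx hw hh hxw) (b₂ x w t h hx hw hh hxw))
    (b₃ x w t h hx hw hh hxw)) (b₄ x w t h hx hw hh hxw)

lemma exists_Kker_bound {δ βF ρ' c₂ : ℝ} {Λ : Set ℝ} {μ : Measure ℝ} [IsProbabilityMeasure μ]
    (hsupp : μ Λᶜ = 0)
    (hFourier : ∀ K : ℝ, 1 ≤ K → ∃ C_K : ℝ, 0 < C_K ∧
      ∀ (φ : ℝ → ℝ) (g : ℝ → ℂ), ContDiff ℝ 2 φ → ContDiff ℝ 1 g →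
        (∀ x : ℝ, |φ x| + |deriv φ x| + |deriv (deriv φ) x| + ‖g x‖ + ‖deriv g x‖ ≤ K) →
        (∀ x ∈ Λ, 1 / K ≤ |deriv φ x|) →
        ∀ ξ : ℝ, 1 < |ξ| →
          ‖∫ x : ℝ, Complex.exp (Complex.I * (ξ : ℂ) * ((φ x : ℝ) : ℂ)) * g x ∂μ‖
            ≤ C_K * |ξ| ^ (-βF / 2))
    (hρ' : 0 < ρ') (hc₂ : 0 < c₂) {R : ℝ} (hR : 0 < R) (hΛR : ∀ y ∈ Λ, |y| ≤ R)
    {G : ℝ × ℝ → ℝ} (hG : ContDiff ℝ 1 G) (hGsupp : HasCompactSupport G)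
    (hGdiag : ∀ p : ℝ × ℝ, p ∈ tsupport G → p.1 ≠ p.2) :
    ∃ C : ℝ, 0 < C ∧ ∀ x w h : ℝ, |x| ≤ R → |w| ≤ R → 0 < h → h < 1 →
      ‖Kker μ δ ρ' c₂ G h x w‖ ≤ C * (c₂ * h ^ ρ') ^ (1 - δ) ∧
      (h < |x - w| → ‖Kker μ δ ρ' c₂ G h x w‖
        ≤ C * (c₂ * h ^ ρ') ^ (1 - δ) * (|x - w| / h) ^ (-βF / 2)) := by
  obtain ⟨C, hC, hosc⟩ := exists_oscillatory_bound hsupp hFourier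
    (R := R + 2 * c₂) (by linarith) (fun y hy => (hΛR y hy).trans (by linarith)) hG hGsupp hGdiag
  obtain ⟨M, hM, hGM, -⟩ := exists_norm_le_and_norm_fderiv_le hG hGsupp
  refine ⟨max C (M * M), by positivity, fun x w h hx hw hh hh1 => ?_⟩
  have hH : 0 < c₂ * h ^ ρ' := by positivity
  have hHle : c₂ * h ^ ρ' ≤ c₂ :=
    mul_le_of_le_one_right hc₂.le (Real.rpow_le_one hh.le hh1.le hρ'.le)
  have hGc := hG.continuous
  let f : ℝ → ℂ := fun η => logPhase h x w η * ((G (x, η) * G (w, η) : ℝ) : ℂ)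
  have hf : Measurable f :=
    (measurable_logPhase h x w).mul (Continuous.measurable (by fun_prop))
  have hfM : ∀ η, ‖f η‖ ≤ M * M := by
    intro η
    simp only [f]
    rw [norm_mul, norm_logPhase, one_mul, Complex.norm_real, norm_mul]
    exact mul_le_mul (hGM _) (hGM _) (norm_nonneg _) hM.le
  have hfi : Integrable f := by
    have hcs : HasCompactSupport fun η : ℝ => ((G (x, η) * G (w, η) : ℝ) : ℂ) := by
      refine HasCompactSupport.intro (hGsupp.isCompact.image continuous_snd) fun η hη => ?_
      have : G (x, η) = 0 := by
        by_contra h0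
        exact hη ⟨(x, η), subset_tsupport G h0, rfl⟩
      simp [this]
    have hc : Continuous fun η : ℝ => ((G (x, η) * G (w, η) : ℝ) : ℂ) := by fun_prop
    exact (hc.integrable_of_hasCompactSupport hcs).bdd_mul
      (measurable_logPhase h x w).aestronglyMeasurable
      (Filter.Eventually.of_forall fun η => (norm_logPhase h x w η).le)
  have hK : Kker μ δ ρ' c₂ G h x w = ∫ η, ((Fmu μ δ (c₂ * h ^ ρ') η : ℝ) : ℂ) * f η := by
    unfold Kker
    congr 1
    funext η
    simp only [f, logPhase]
    push_cast
    ring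
  rw [hK]
  constructor
  · refine (norm_integral_Fmu_mul_le hH hf hfi hfM (A := M * M) fun t _ => ?_).trans ?_
    · have := norm_integral_le_of_norm_le_const (μ := μ) (f := fun y => f (y + t))
        (Filter.Eventually.of_forall fun y => hfM (y + t))
      simpa using this
    · rw [mul_comm]
      gcongr
      exact le_max_right _ _
  · intro hxw
    refine (norm_integral_Fmu_mul_le hH hf hfi hfM fun t ht =>
      hosc x w t h ?_ ?_ hh hxw).trans ?_
    · exact (abs_sub _ _).trans (by linarith)
    · exact (abs_sub _ _).trans (by linarith)
    · rw [← mul_assoc, mul_comm _ C]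
      gcongr
      exact le_max_left _ _

open scoped Pointwise in
lemma isCompact_nbhd {Λ : Set ℝ} (hΛ : IsCompact Λ) (α : ℝ) : IsCompact (nbhd Λ α) := by
  have : nbhd Λ α = Λ + Set.Icc (-α) α := by
    ext x
    simp only [nbhd, Set.mem_ofPred_eq, Set.mem_add]
    constructor
    · rintro ⟨y, hy, h⟩
      exact ⟨y, hy, x - y, abs_le.1 h, by ring⟩
    · rintro ⟨y, hy, z, hz, rfl⟩
      exact ⟨y, hy, by rw [add_sub_cancel_left]; exact abs_le.2 hz⟩
  rw [this]
  exact hΛ.add isCompact_Icc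

lemma exists_volume_nbhd_le {δ C_R : ℝ} {Λ : Set ℝ} (hΛc : IsCompact Λ) (hCR : 0 < C_R)
    (hreg : ∀ x₀ ∈ Λ, ∀ α α' : ℝ, 0 < α → α ≤ α' → α' ≤ 1 →
      volume (nbhd Λ α ∩ Set.Icc (x₀ - α') (x₀ + α'))
        ≤ ENNReal.ofReal (C_R * α ^ (1 - δ) * α' ^ δ)) :
    ∃ D : ℝ, 0 < D ∧ ∀ α : ℝ, 0 < α → α ≤ 1 / 2 →
      volume.real (nbhd Λ α) ≤ D * α ^ (1 - δ) := by
  obtain ⟨t, htΛ, htf, hcov⟩ := hΛc.finite_cover_balls (e := 1 / 2) (by norm_num)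
  refine ⟨(htf.toFinset.card + 1) * C_R, by positivity, fun α hα hα2 => ?_⟩
  have hsub : nbhd Λ α ⊆ ⋃ x₀ ∈ htf.toFinset, nbhd Λ α ∩ Set.Icc (x₀ - 1) (x₀ + 1) := by
    rintro x ⟨y, hy, hxy⟩
    obtain ⟨x₀, hx₀, hyx₀⟩ := Set.mem_iUnion₂.1 (hcov hy)
    refine Set.mem_iUnion₂.2 ⟨x₀, htf.mem_toFinset.2 hx₀, ⟨y, hy, hxy⟩, ?_⟩
    rw [Metric.mem_ball, Real.dist_eq, abs_lt] at hyx₀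
    rw [abs_le] at hxy
    constructor <;> linarith [hyx₀.1, hyx₀.2, hxy.1, hxy.2]
  have hle : volume (nbhd Λ α) ≤ ENNReal.ofReal (htf.toFinset.card * (C_R * α ^ (1 - δ))) := by
    refine (measure_mono hsub).trans ((measure_biUnion_finset_le _ _).trans ?_)
    refine (Finset.sum_le_card_nsmul _ _ (ENNReal.ofReal (C_R * α ^ (1 - δ)))
      fun x₀ hx₀ => ?_).trans ?_
    · simpa using hreg x₀ (htΛ (htf.mem_toFinset.1 hx₀)) α 1 hα (by linarith) le_rfl
    · rw [ENNReal.ofReal_mul (Nat.cast_nonneg _), nsmul_eq_mul, ENNReal.ofReal_natCast]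
  refine (ENNReal.toReal_le_of_le_ofReal (by positivity) hle).trans ?_
  have : 0 < C_R * α ^ (1 - δ) := by positivity
  linarith

lemma exists_small_scale {ρ c₁ : ℝ} (hρ : 1 / 2 < ρ) :
    ∃ h₀ : ℝ, 0 < h₀ ∧ ∀ h : ℝ, 0 < h → h < h₀ →
      h < 1 ∧ 2 * h ^ (1 / 2 : ℝ) ≤ 1 ∧ c₁ * h ^ ρ ≤ h ^ (1 / 2 : ℝ) := by
  have lim : ∀ {e : ℝ}, 0 < e → ∀ c : ℝ,
      Filter.Tendsto (fun h : ℝ => c * h ^ e) (nhdsWithin 0 (Set.Ioi 0)) (nhds 0) := by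
    intro e he c
    have h1 : Filter.Tendsto (fun h : ℝ => c * h ^ e) (nhds 0) (nhds (c * 0 ^ e)) :=
      ((Real.continuous_rpow_const he.le).tendsto 0).const_mul c
    rw [Real.zero_rpow he.ne', mul_zero] at h1
    exact h1.mono_left nhdsWithin_le_nhds
  have e1 := (lim one_pos 1).eventually_lt_const one_pos
  have e2 := (lim one_half_pos 2).eventually_lt_const one_pos
  have e3 := (lim (sub_pos.2 hρ) c₁).eventually_lt_const one_pos
  obtain ⟨h₀, hh₀, hsub⟩ := mem_nhdsGT_iff_exists_Ioo_subset.1 (e1.and (e2.and e3))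
  refine ⟨h₀, hh₀, fun h hh hlt => ?_⟩
  obtain ⟨a1, a2, a3⟩ := hsub ⟨hh, hlt⟩
  refine ⟨by simpa using a1, a2.le, ?_⟩
  have hpos : 0 < h ^ (1 / 2 : ℝ) := by positivity
  calc c₁ * h ^ ρ = c₁ * h ^ (ρ - 1 / 2) * h ^ (1 / 2 : ℝ) := by
        rw [mul_assoc, ← Real.rpow_add hh]
        ring_nf
    _ ≤ 1 * h ^ (1 / 2 : ℝ) := by gcongr
    _ = _ := one_mul _

/-- A square-integral bound over `T × T` for a kernel with off-diagonal decay. -/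
lemma setIntegral_setIntegral_norm_sq_le {T : Set ℝ} (hT : IsCompact T) {k : ℝ → ℝ → ℂ}
    {B τ s V W : ℝ} (hB : 0 ≤ B) (hτ : 0 ≤ τ) (hV : volume.real T ≤ V) (hW : 0 ≤ W)
    (hnear : ∀ x ∈ T, volume.real (T ∩ Set.Icc (x - s) (x + s)) ≤ W)
    (hk : ∀ x ∈ T, ∀ w ∈ T, ‖k x w‖ ^ 2 ≤ B)
    (hk' : ∀ x ∈ T, ∀ w ∈ T, s < |x - w| → ‖k x w‖ ^ 2 ≤ B * τ) :
    ∫ x in T, ∫ w in T, ‖k x w‖ ^ 2 ≤ B * (τ * V + W) * V := by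
  have hfin : volume T ≠ ⊤ := hT.measure_lt_top.ne
  have hV0 : 0 ≤ V := measureReal_nonneg.trans hV
  have inner : ∀ x ∈ T, ∫ w in T, ‖k x w‖ ^ 2 ≤ B * (τ * V + W) := by
    intro x hx
    have i1 : IntegrableOn (fun _ : ℝ => B * τ) T := integrableOn_const hfin
    have i2 : IntegrableOn ((Set.Icc (x - s) (x + s)).indicator fun _ : ℝ => B) T :=
      (integrableOn_const (C := B) hfin).indicator measurableSet_Icc
    calc ∫ w in T, ‖k x w‖ ^ 2
        ≤ ∫ w in T, (B * τ + (Set.Icc (x - s) (x + s)).indicator (fun _ => B) w) := by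
          refine integral_mono_of_nonneg (Filter.Eventually.of_forall fun w => sq_nonneg _)
            (i1.add i2) ?_
          filter_upwards [ae_restrict_mem hT.measurableSet] with w hw
          by_cases hws : w ∈ Set.Icc (x - s) (x + s)
          · rw [Set.indicator_of_mem hws]
            exact (hk x hx w hw).trans (le_add_of_nonneg_left (by positivity))
          · rw [Set.indicator_of_notMem hws, add_zero]
            refine hk' x hx w hw (not_le.1 fun hle => hws ?_)
            rw [abs_le] at hle
            constructor <;> linarith [hle.1, hle.2]
      _ = volume.real T * (B * τ) + volume.real (T ∩ Set.Icc (x - s) (x + s)) * B := by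
          rw [integral_add i1 i2, setIntegral_const, setIntegral_indicator measurableSet_Icc,
            setIntegral_const, smul_eq_mul, smul_eq_mul]
      _ ≤ V * (B * τ) + W * B := by
          gcongr
          exact hnear x hx
      _ = B * (τ * V + W) := by ring
  calc ∫ x in T, ∫ w in T, ‖k x w‖ ^ 2 ≤ ∫ _ in T, B * (τ * V + W) := by
        refine integral_mono_of_nonneg
          (Filter.Eventually.of_forall fun x => integral_nonneg fun w => sq_nonneg _)
          (integrableOn_const hfin) ?_
        filter_upwards [ae_restrict_mem hT.measurableSet] with x hx using inner x hx
    _ = volume.real T * (B * (τ * V + W)) := by rw [setIntegral_const, smul_eq_mul]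
    _ ≤ V * (B * (τ * V + W)) := by gcongr
    _ = _ := mul_comm _ _

/-- A general form of Lemma 2.3: under Ahlfors–David upper regularity and
the Bourgain–Dyatlov Fourier decay hypothesis for the measure `μ` supported on the compact
set `Λ`, one has `I(h) ≤ C h^{2ρ'(1-δ) + 2ρ(1-δ) + β_F/2}` for all small `h > 0`. -/
theorem stmt12 (δ βF : ℝ) (hδ : δ ∈ Set.Ioo (0 : ℝ) 1) (hβF : βF ∈ Set.Ioc (0 : ℝ) δ)
    (Λ : Set ℝ) (hΛne : Λ.Nonempty) (hΛc : IsCompact Λ)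
    (μ : Measure ℝ) (hμ : IsProbabilityMeasure μ) (hsupp : μ Λᶜ = 0)
    (C_R : ℝ) (hCR : 0 < C_R)
    (hreg : ∀ x₀ ∈ Λ, ∀ α α' : ℝ, 0 < α → α ≤ α' → α' ≤ 1 →
      volume (nbhd Λ α ∩ Set.Icc (x₀ - α') (x₀ + α'))
        ≤ ENNReal.ofReal (C_R * α ^ (1 - δ) * α' ^ δ))
    (hFourier : ∀ K : ℝ, 1 ≤ K → ∃ C_K : ℝ, 0 < C_K ∧
      ∀ (φ : ℝ → ℝ) (g : ℝ → ℂ), ContDiff ℝ 2 φ → ContDiff ℝ 1 g →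
        (∀ x : ℝ, |φ x| + |deriv φ x| + |deriv (deriv φ) x| + ‖g x‖ + ‖deriv g x‖ ≤ K) →
        (∀ x ∈ Λ, 1 / K ≤ |deriv φ x|) →
        ∀ ξ : ℝ, 1 < |ξ| →
          ‖∫ x : ℝ, Complex.exp (Complex.I * (ξ : ℂ) * ((φ x : ℝ) : ℂ)) * g x ∂μ‖
            ≤ C_K * |ξ| ^ (-βF / 2))
    (ρ ρ' c₁ c₂ : ℝ) (hρ : ρ ∈ Set.Ioo (1 / 2 : ℝ) 1) (hρ' : ρ' ∈ Set.Ioo (0 : ℝ) 1)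
    (hc₁ : 0 < c₁) (hc₂ : 0 < c₂)
    (G : ℝ × ℝ → ℝ) (hGsmooth : ContDiff ℝ (⊤ : ℕ∞) G) (hGsupp : HasCompactSupport G)
    (hGdiag : ∀ p : ℝ × ℝ, p ∈ tsupport G → p.1 ≠ p.2) :
    ∃ C : ℝ, 0 < C ∧ ∃ h₀ : ℝ, 0 < h₀ ∧ ∀ h : ℝ, 0 < h → h < h₀ →
      Ih μ Λ δ ρ ρ' c₁ c₂ G h
        ≤ C * h ^ (2 * ρ' * (1 - δ) + 2 * ρ * (1 - δ) + βF / 2) := by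
  obtain ⟨hδ0, hδ1⟩ := hδ
  obtain ⟨hβ0, hβδ⟩ := hβF
  obtain ⟨R₀, hR₀⟩ := hΛc.isBounded.exists_norm_le
  have hR₀0 : 0 ≤ R₀ := hΛne.elim fun y hy => (norm_nonneg y).trans (hR₀ y hy)
  obtain ⟨C, hC, hK⟩ := exists_Kker_bound (δ := δ) hsupp hFourier hρ'.1 hc₂ (R := R₀ + c₁)
    (by linarith) (fun y hy => (hR₀ y hy).trans (by linarith)) (hGsmooth.of_le (by simp)) hGsupp
    hGdiag
  obtain ⟨D, hD, hvol⟩ := exists_volume_nbhd_le hΛc hCR hreg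
  obtain ⟨h₀, hh₀, hsmall⟩ := exists_small_scale (c₁ := c₁) hρ.1
  refine ⟨C ^ 2 * (c₂ ^ (1 - δ)) ^ 2 * (D + 2 * C_R) * D * (c₁ ^ (1 - δ)) ^ 2, by positivity, h₀,
    hh₀, fun h hh hlt => ?_⟩
  obtain ⟨hh1, hs2, hαs⟩ := hsmall h hh hlt
  have hα : 0 < c₁ * h ^ ρ := by positivity
  have hs0 : 0 < h ^ (1 / 2 : ℝ) := by positivity
  have hhs : h < h ^ (1 / 2 : ℝ) := by
    simpa using Real.rpow_lt_rpow_of_exponent_gt hh hh1 (show (1 / 2 : ℝ) < 1 by norm_num)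
  have hTR : ∀ x ∈ nbhd Λ (c₁ * h ^ ρ), |x| ≤ R₀ + c₁ := by
    rintro x ⟨y, hy, hxy⟩
    have h1 : c₁ * h ^ ρ ≤ c₁ :=
      mul_le_of_le_one_right hc₁.le (Real.rpow_le_one hh.le hh1.le (by linarith [hρ.1]))
    have h2 : |y| ≤ R₀ := hR₀ y hy
    calc |x| = |y + (x - y)| := by ring_nf
      _ ≤ |y| + |x - y| := abs_add_le _ _
      _ ≤ R₀ + c₁ := by linarith
  have hnear : ∀ x ∈ nbhd Λ (c₁ * h ^ ρ),
      volume.real (nbhd Λ (c₁ * h ^ ρ) ∩ Set.Icc (x - h ^ (1 / 2 : ℝ)) (x + h ^ (1 / 2 : ℝ)))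
        ≤ 2 * C_R * (c₁ * h ^ ρ) ^ (1 - δ) * h ^ (βF / 2) := by
    rintro x ⟨y, hy, hxy⟩
    rw [abs_le] at hxy
    have hle := (measure_mono (Set.inter_subset_inter_right (nbhd Λ (c₁ * h ^ ρ))
      (Set.Icc_subset_Icc (show y - 2 * h ^ (1 / 2 : ℝ) ≤ x - h ^ (1 / 2 : ℝ) by linarith [hxy.1])
        (show x + h ^ (1 / 2 : ℝ) ≤ y + 2 * h ^ (1 / 2 : ℝ) by linarith [hxy.2])))).trans
      (hreg y hy (c₁ * h ^ ρ) (2 * h ^ (1 / 2 : ℝ)) hα (by linarith) hs2)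
    refine (ENNReal.toReal_le_of_le_ofReal (by positivity) hle).trans ?_
    have h2 : (2 : ℝ) ^ δ ≤ 2 := by
      simpa using Real.rpow_le_rpow_of_exponent_le one_le_two hδ1.le
    have h3 : (h ^ (1 / 2 : ℝ)) ^ δ ≤ h ^ (βF / 2) := by
      rw [← Real.rpow_mul hh.le]
      exact Real.rpow_le_rpow_of_exponent_ge hh hh1.le (by linarith)
    calc C_R * (c₁ * h ^ ρ) ^ (1 - δ) * (2 * h ^ (1 / 2 : ℝ)) ^ δ
        = C_R * (c₁ * h ^ ρ) ^ (1 - δ) * (2 ^ δ * (h ^ (1 / 2 : ℝ)) ^ δ) := by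
          rw [Real.mul_rpow zero_le_two hs0.le]
      _ ≤ C_R * (c₁ * h ^ ρ) ^ (1 - δ) * (2 * h ^ (βF / 2)) := by gcongr
      _ = _ := by ring
  have hfar : ∀ x w : ℝ, h ^ (1 / 2 : ℝ) < |x - w| →
      ((|x - w| / h) ^ (-βF / 2)) ^ 2 ≤ h ^ (βF / 2) := by
    intro x w hxw
    have h1 : h ^ (-(1 / 2) : ℝ) ≤ |x - w| / h := by
      rw [le_div_iff₀ hh]
      refine le_trans (le_of_eq ?_) hxw.le
      nth_rewrite 2 [← Real.rpow_one h]
      rw [← Real.rpow_add hh]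
      norm_num
    have h2 : (|x - w| / h) ^ (-βF / 2) ≤ h ^ (βF / 4) := by
      refine (Real.rpow_le_rpow_of_nonpos (by positivity) h1 (by linarith)).trans (le_of_eq ?_)
      rw [← Real.rpow_mul hh.le]
      ring_nf
    calc ((|x - w| / h) ^ (-βF / 2)) ^ 2 ≤ (h ^ (βF / 4)) ^ 2 := by gcongr
      _ = h ^ (βF / 2) := by
        rw [← Real.rpow_natCast, ← Real.rpow_mul hh.le]
        norm_num
        ring_nf
  have hmain := setIntegral_setIntegral_norm_sq_le (isCompact_nbhd hΛc (c₁ * h ^ ρ))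
    (k := Kker μ δ ρ' c₂ G h) (B := (C * (c₂ * h ^ ρ') ^ (1 - δ)) ^ 2) (τ := h ^ (βF / 2))
    (by positivity) (by positivity) (hvol _ hα (by linarith)) (by positivity) hnear
    (fun x hx w hw => by
      have := (hK x w h (hTR x hx) (hTR w hw) hh hh1).1
      gcongr)
    (fun x hx w hw hxw => by
      have := (hK x w h (hTR x hx) (hTR w hw) hh hh1).2 (hhs.trans hxw)
      calc ‖Kker μ δ ρ' c₂ G h x w‖ ^ 2
          ≤ (C * (c₂ * h ^ ρ') ^ (1 - δ) * (|x - w| / h) ^ (-βF / 2)) ^ 2 := by gcongr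
        _ = (C * (c₂ * h ^ ρ') ^ (1 - δ)) ^ 2 * ((|x - w| / h) ^ (-βF / 2)) ^ 2 := by ring
        _ ≤ _ := by
          gcongr
          exact hfar x w hxw)
  refine hmain.trans (le_of_eq ?_)
  have hexp : h ^ (2 * ρ' * (1 - δ) + 2 * ρ * (1 - δ) + βF / 2) =
      (h ^ (ρ' * (1 - δ))) ^ 2 * (h ^ (ρ * (1 - δ))) ^ 2 * h ^ (βF / 2) := by
    rw [Real.rpow_add hh, Real.rpow_add hh, ← Real.rpow_natCast (h ^ (ρ' * (1 - δ))),
      ← Real.rpow_natCast (h ^ (ρ * (1 - δ))), ← Real.rpow_mul hh.le, ← Real.rpow_mul hh.le]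
    push_cast
    ring_nf
  rw [hexp, Real.mul_rpow hc₂.le (by positivity), Real.mul_rpow hc₁.le (by positivity),
    ← Real.rpow_mul hh.le, ← Real.rpow_mul hh.le]
  ring
end
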